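/- arXiv:2501.07682 — 6 statements merged into one kernel-verified Lean document; each statement's English description precedes it below -/
import Mathlib

section
/- For every real number α ≥ 2 and every real number q, one has cosh(q/α) − cos(π/α) ≥ (1/(2α²))·(q² + π²/2). -/
open Real

lemma one_add_sq_div_two_le_cosh (x : ℝ) : 1 + x ^ 2 / 2 ≤ Real.cosh x := by
  wlog hx : 0 ≤ x generalizing x
  · simpa using this (-x) (by linarith)
  have hsinh : x / 2 ≤ Real.sinh (x / 2) := Real.self_le_sinh_iff.2 (by linarith)
  have hcosh : Real.cosh x = Real.cosh (x / 2) ^ 2 + Real.sinh (x / 2) ^ 2 := by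
    rw [← Real.cosh_two_mul]
    ring_nf
  nlinarith [Real.cosh_sq (x / 2)]

lemma cos_le_one_sub_sq_div_four {x : ℝ} (hx₀ : 0 < x) (hx : x ≤ π / 2) :
    Real.cos x ≤ 1 - x ^ 2 / 4 := by
  have hx2 : x / 2 ≤ 4 / 5 := by linarith [Real.pi_lt_d2]
  have hsin : x / 2 - (x / 2) ^ 3 / 6 < Real.sin (x / 2) :=
    Real.sin_gt_sub_cube (by linarith)
  have hcos : Real.cos x = 2 * Real.cos (x / 2) ^ 2 - 1 := by
    rw [← Real.cos_two_mul]
    ring_nf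
  have hlower : 21 / 25 * (x / 2) ≤ Real.sin (x / 2) := by
    have hsq : (x / 2) ^ 2 ≤ 16 / 25 := by nlinarith
    nlinarith
  nlinarith [Real.sin_sq_add_cos_sq (x / 2)]

theorem cosh_sub_cos_lower_bound (α q : ℝ) (hα : 2 ≤ α) :
    Real.cosh (q / α) - Real.cos (π / α) ≥ (1 / (2 * α ^ 2)) * (q ^ 2 + π ^ 2 / 2) := by
  have hcosh := one_add_sq_div_two_le_cosh (q / α)
  have hcos : Real.cos (π / α) ≤ 1 - (π / α) ^ 2 / 4 :=
    cos_le_one_sub_sq_div_four (div_pos Real.pi_pos (by linarith))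
      (div_le_div_of_nonneg_left Real.pi_pos.le two_pos hα)
  have hsum : (1 / (2 * α ^ 2)) * (q ^ 2 + π ^ 2 / 2) = (q / α) ^ 2 / 2 + (π / α) ^ 2 / 4 := by
    field_simp
    ring
  linarith
end

section
/- For every real α ≥ 2 and all ε, t > 0, one has (1/(4π))·sin(π/α)·∫₀^∞ e^{−ε²(1+cosh q)/(2t)} · (1 + cosh q)⁻¹ · (cosh(q/α) − cos(π/α))⁻¹ dq ≤ (α/2)·e^{−ε²/t}. -/
open Real MeasureTheory

theorem wedge_remainder_bound (α ε t : ℝ) (hα : 2 ≤ α) (hε : 0 < ε) (ht : 0 < t) :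
    (1 / (4 * π)) * Real.sin (π / α) *
        ∫ q in Set.Ioi (0 : ℝ),
          Real.exp (-ε ^ 2 * (1 + Real.cosh q) / (2 * t)) * (1 + Real.cosh q)⁻¹ *
            (Real.cosh (q / α) - Real.cos (π / α))⁻¹
      ≤ (α / 2) * Real.exp (-ε ^ 2 / t) := by
  have hα0 : 0 < α := by linarith
  obtain ⟨s, hs⟩ : ∃ s, s = π / α := ⟨_, rfl⟩
  rw [← hs]
  have hs0 : 0 < s := hs ▸ by positivity
  have hsα : s * α = π := by rw [hs]; field_simp
  have hsπ : s ≤ π := by nlinarith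
  have hsin0 : 0 ≤ sin s := sin_nonneg_of_nonneg_of_le_pi hs0.le hsπ
  have hcos : 2 / π ^ 2 * s ^ 2 ≤ 1 - cos s := by
    linarith [cos_le_one_sub_mul_cos_sq (abs_le.2 ⟨by linarith, hsπ⟩)]
  have hc : 0 < 1 - cos s := lt_of_lt_of_le (by positivity) hcos
  have hint : ∫ q in Set.Ioi (0 : ℝ),
      exp (-ε ^ 2 * (1 + cosh q) / (2 * t)) * (1 + cosh q)⁻¹ * (cosh (q / α) - cos s)⁻¹
      ≤ ∫ q in Set.Ioi (0 : ℝ), exp (-ε ^ 2 / t) * (1 - cos s)⁻¹ * 2 * exp (-q) := by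
    have hpos (q : ℝ) : 1 - cos s ≤ cosh (q / α) - cos s := by
      linarith [one_le_cosh (q / α)]
    refine integral_mono_of_nonneg (ae_of_all _ fun q ↦ ?_)
      ((integrableOn_exp_neg_Ioi 0).const_mul _) (ae_of_all _ fun q ↦ ?_)
    · have h1 := one_le_cosh q
      have h2 : 0 ≤ cosh (q / α) - cos s := hc.le.trans (hpos q)
      simp only [Pi.zero_apply]
      positivity
    · have h1 : exp (-ε ^ 2 * (1 + cosh q) / (2 * t)) ≤ exp (-ε ^ 2 / t) := by
        rw [exp_le_exp, div_le_div_iff₀ (by positivity) ht]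
        have : 0 ≤ ε ^ 2 * t * (cosh q - 1) :=
          mul_nonneg (by positivity) (by linarith [one_le_cosh q])
        linarith
      have h2 : (1 + cosh q)⁻¹ ≤ 2 * exp (-q) := by
        rw [exp_neg, ← div_eq_mul_inv, ← inv_div]
        refine inv_anti₀ (by positivity) ?_
        rw [cosh_eq]
        linarith [exp_pos (-q)]
      have h3 : (cosh (q / α) - cos s)⁻¹ ≤ (1 - cos s)⁻¹ := inv_anti₀ hc (hpos q)
      have h4 := cosh_pos q
      calc _ ≤ exp (-ε ^ 2 / t) * (2 * exp (-q)) * (1 - cos s)⁻¹ :=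
            mul_le_mul (mul_le_mul h1 h2 (by positivity) (by positivity)) h3
              (inv_nonneg.2 (hc.le.trans (hpos q))) (by positivity)
        _ = _ := by ring
  rw [integral_const_mul, integral_exp_neg_Ioi_zero, mul_one] at hint
  have hkey : sin s ≤ α * π * (1 - cos s) := by
    calc sin s ≤ s := sin_le hs0.le
      _ ≤ 2 * s := by linarith
      _ = α * π * (2 / π ^ 2 * s ^ 2) := by rw [← hsα]; field_simp
      _ ≤ _ := by gcongr
  calc _ ≤ 1 / (4 * π) * sin s * (exp (-ε ^ 2 / t) * (1 - cos s)⁻¹ * 2) := by gcongr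
    _ ≤ 1 / (4 * π) * (α * π * (1 - cos s)) * (exp (-ε ^ 2 / t) * (1 - cos s)⁻¹ * 2) := by
      gcongr
    _ = _ := by field_simp; ring
end

section
/- With the hypotheses and notation of the context, the function Z is complex differentiable at every point of the set {s ∈ ℂ : Re s > −q, s ≠ 1, s ≠ 1/2}, and for every s with Re s > 1 one has Z(s) = Σ_{n≥1} λₙ^{−s}. In particular, Z provides an analytic continuation of the spectral zeta function ζ(s) = Σ_{n≥1} λₙ^{−s} to a neighborhood of s = 0. -/
open Real MeasureTheory Complex

open Set Filter Topology Asymptotics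

section HeatTrace

variable {lam : ℕ → ℝ} {c : ℝ}

theorem summable_exp_neg_mul_of_linear_growth (hc : 0 < c)
    (hgrowth : ∀ n, c * (n + 1) ≤ lam n) {t : ℝ} (ht : 0 < t) :
    Summable fun n ↦ Real.exp (-t * lam n) := by
  have hgeom : Summable fun n : ℕ ↦ Real.exp (n * -(t * c)) :=
    Real.summable_exp_nat_mul_iff.mpr (neg_lt_zero.mpr (mul_pos ht hc))
  refine hgeom.of_nonneg_of_le (fun n ↦ (Real.exp_pos _).le) fun n ↦ ?_
  refine Real.exp_le_exp.mpr ?_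
  nlinarith [mul_le_mul_of_nonneg_left (hgrowth n) ht.le, mul_pos ht hc]

theorem summable_one_div_rpow_of_linear_growth (hc : 0 < c)
    (hgrowth : ∀ n, c * (n + 1) ≤ lam n) {σ : ℝ} (hσ : 1 < σ) :
    Summable fun n ↦ 1 / lam n ^ σ := by
  have hp : Summable fun n : ℕ ↦ (c ^ σ)⁻¹ * (((n + 1 : ℕ) : ℝ) ^ σ)⁻¹ :=
    ((summable_nat_add_iff 1).mpr (Real.summable_nat_rpow_inv.mpr hσ)).mul_left _
  have hpos (n : ℕ) : 0 < c * (n + 1) := by positivity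
  refine hp.of_nonneg_of_le (fun n ↦ ?_) fun n ↦ ?_
  · have := (hpos n).trans_le (hgrowth n)
    positivity
  · rw [← mul_inv, ← Real.mul_rpow hc.le (by positivity), one_div]
    push_cast
    have := Real.rpow_pos_of_pos (hpos n) σ
    gcongr
    exact hgrowth n

theorem continuousOn_tsum_exp_neg_mul (hc : 0 < c) (hgrowth : ∀ n, c * (n + 1) ≤ lam n) :
    ContinuousOn (fun t ↦ ∑' n, Real.exp (-t * lam n)) (Ioi 0) := by
  intro t (ht : 0 < t)
  have hcont : ContinuousOn (fun t ↦ ∑' n, Real.exp (-t * lam n)) (Ici (t / 2)) := by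
    refine continuousOn_tsum (fun n ↦ by fun_prop)
      (summable_exp_neg_mul_of_linear_growth hc hgrowth (half_pos ht)) fun n x hx ↦ ?_
    rw [Real.norm_of_nonneg (Real.exp_pos _).le]
    have hlam : 0 ≤ lam n := le_trans (by positivity) (hgrowth n)
    exact Real.exp_le_exp.mpr
      (mul_le_mul_of_nonneg_right (neg_le_neg hx) hlam)
  exact (hcont.continuousAt (Ici_mem_nhds (half_lt_self ht))).continuousWithinAt

theorem isBigO_tsum_exp_neg_mul (hmono : Monotone lam) (hc : 0 < c)
    (hgrowth : ∀ n, c * (n + 1) ≤ lam n) :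
    (fun t ↦ ∑' n, Real.exp (-t * lam n)) =O[atTop] fun t ↦ Real.exp (-lam 0 * t) := by
  have hsum := summable_exp_neg_mul_of_linear_growth hc hgrowth one_pos
  refine IsBigO.of_bound ((∑' n, Real.exp (-1 * lam n)) * Real.exp (lam 0)) ?_
  filter_upwards [eventually_ge_atTop 1] with t ht
  rw [Real.norm_of_nonneg (tsum_nonneg fun n ↦ (Real.exp_pos _).le),
    Real.norm_of_nonneg (Real.exp_pos _).le, mul_assoc, ← Real.exp_add, ← tsum_mul_right]
  refine (summable_exp_neg_mul_of_linear_growth hc hgrowth (one_pos.trans_le ht)).tsum_le_tsum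
    (fun n ↦ ?_) (hsum.mul_right _)
  rw [← Real.exp_add]
  refine Real.exp_le_exp.mpr ?_
  nlinarith [mul_le_mul_of_nonneg_left (hmono n.zero_le) (sub_nonneg.mpr ht)]

end HeatTrace

theorem MeasureTheory.LocallyIntegrableOn.indicator_of_isOpen {f : ℝ → ℂ} {s t : Set ℝ}
    (hf : LocallyIntegrableOn f s) (hs : IsOpen s) (ht : MeasurableSet t) :
    LocallyIntegrableOn (t.indicator f) s := by
  rw [locallyIntegrableOn_iff hs.isLocallyClosed] at hf ⊢
  exact fun k hks hk ↦ (hf k hks hk).indicator ht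

theorem mellin_eq_integral_Ioc_add_integral_Ioi {f : ℝ → ℂ} {s : ℂ} (hf : MellinConvergent f s) :
    mellin f s = (∫ t in Ioc (0 : ℝ) 1, (t : ℂ) ^ (s - 1) * f t) +
      ∫ t in Ioi (1 : ℝ), (t : ℂ) ^ (s - 1) * f t := by
  have hf' : IntegrableOn (fun t : ℝ ↦ (t : ℂ) ^ (s - 1) * f t) (Ioi 0) := hf
  simp only [mellin, smul_eq_mul]
  rw [← Ioc_union_Ioi_eq_Ioi zero_le_one]
  exact setIntegral_union (Ioc_disjoint_Ioi le_rfl) measurableSet_Ioi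
    (hf'.mono_set Ioc_subset_Ioi_self) (hf'.mono_set (Ioi_subset_Ioi zero_le_one))

section Regularized

variable (θ : ℝ → ℝ) (a b d : ℝ)

/-- The polar part `a t⁻¹ + b t^(-1/2) + d` of a heat trace expansion, truncated to `(0, 1]`. -/
noncomputable def heatPolarPart (t : ℝ) : ℂ :=
  a * (Ioc 0 1).indicator (fun t : ℝ ↦ (t : ℂ) ^ (-1 : ℂ)) t +
    b * (Ioc 0 1).indicator (fun t : ℝ ↦ (t : ℂ) ^ (-(1 / 2) : ℂ)) t +
    d * (Ioc 0 1).indicator (fun _ : ℝ ↦ (1 : ℂ)) t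

/-- A heat trace minus its truncated polar part. -/
noncomputable def regularizedHeatTrace (t : ℝ) : ℂ := θ t - heatPolarPart a b d t

variable {θ a b d}

theorem regularizedHeatTrace_of_mem_Ioc {t : ℝ} (ht : t ∈ Ioc (0 : ℝ) 1) :
    regularizedHeatTrace θ a b d t =
      ((θ t - a * t⁻¹ - b * t ^ (-(1 / 2) : ℝ) - d : ℝ) : ℂ) := by
  simp only [regularizedHeatTrace, heatPolarPart, indicator_of_mem ht, Complex.cpow_neg_one]
  push_cast [Complex.ofReal_cpow ht.1.le]
  ring

theorem regularizedHeatTrace_of_one_lt {t : ℝ} (ht : 1 < t) :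
    regularizedHeatTrace θ a b d t = θ t := by
  have h : t ∉ Ioc (0 : ℝ) 1 := fun h ↦ h.2.not_gt ht
  simp [regularizedHeatTrace, heatPolarPart, indicator_of_notMem h]

theorem locallyIntegrableOn_heatPolarPart :
    LocallyIntegrableOn (heatPolarPart a b d) (Ioi 0) := by
  have hcpow (w : ℂ) : LocallyIntegrableOn
      ((Ioc 0 1).indicator fun t : ℝ ↦ (t : ℂ) ^ w) (Ioi 0) := by
    refine LocallyIntegrableOn.indicator_of_isOpen (ContinuousOn.locallyIntegrableOn
      (fun t ht ↦ ?_) measurableSet_Ioi) isOpen_Ioi measurableSet_Ioc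
    exact (Complex.continuousAt_ofReal_cpow_const t w (Or.inr ht.ne')).continuousWithinAt
  have hone : LocallyIntegrableOn ((Ioc 0 1).indicator fun _ : ℝ ↦ (1 : ℂ)) (Ioi 0) :=
    (locallyIntegrableOn_const 1).indicator_of_isOpen isOpen_Ioi measurableSet_Ioc
  exact (((hcpow _).smul (a : ℂ)).add ((hcpow _).smul (b : ℂ))).add (hone.smul (d : ℂ))

theorem locallyIntegrableOn_regularizedHeatTrace (hθ : ContinuousOn θ (Ioi 0)) :
    LocallyIntegrableOn (regularizedHeatTrace θ a b d) (Ioi 0) :=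
  ((Complex.continuous_ofReal.comp_continuousOn hθ).locallyIntegrableOn measurableSet_Ioi).sub
    locallyIntegrableOn_heatPolarPart

theorem isBigO_regularizedHeatTrace_atTop {r : ℝ}
    (hθ : θ =O[atTop] fun t ↦ Real.exp (-r * t)) :
    regularizedHeatTrace θ a b d =O[atTop] fun t ↦ Real.exp (-r * t) := by
  refine IsBigO.congr' (f₁ := fun t ↦ (θ t : ℂ)) ?_ ?_ EventuallyEq.rfl
  · exact (IsBigO.of_norm_left (by simpa using hθ.norm_left))
  · filter_upwards [eventually_gt_atTop 1] with t ht
    exact (regularizedHeatTrace_of_one_lt ht).symm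

theorem isBigO_regularizedHeatTrace_zero {q C t₀ : ℝ} (ht₀ : 0 < t₀)
    (hasymp : ∀ t ∈ Ioo 0 t₀, |θ t - a * t⁻¹ - b * t ^ (-(1 / 2) : ℝ) - d| ≤ C * t ^ q) :
    regularizedHeatTrace θ a b d =O[𝓝[>] 0] (· ^ q) := by
  refine IsBigO.of_bound C ?_
  filter_upwards [Ioo_mem_nhdsGT ht₀, Ioc_mem_nhdsGT zero_lt_one] with t ht ht1
  rw [regularizedHeatTrace_of_mem_Ioc ht1, Complex.norm_real, Real.norm_eq_abs,
    Real.norm_of_nonneg (Real.rpow_nonneg ht.1.le q)]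
  exact hasymp t ht

theorem hasMellin_heatPolarPart {s : ℂ} (hs : 1 < s.re) :
    HasMellin (heatPolarPart a b d) s (a / (s - 1) + b / (s - 1 / 2) + d / s) := by
  have h1 := hasMellin_cpow_Ioc (-1) (s := s) (by simp; linarith)
  have h2 := hasMellin_cpow_Ioc (-(1 / 2)) (s := s) (by norm_num; linarith)
  have h3 := hasMellin_one_Ioc (s := s) (by linarith)
  have h1' := hasMellin_const_smul h1.1 (a : ℂ)
  have h2' := hasMellin_const_smul h2.1 (b : ℂ)
  have h3' := hasMellin_const_smul h3.1 (d : ℂ)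
  have h12 := hasMellin_add h1'.1 h2'.1
  have h123 := hasMellin_add h12.1 h3'.1
  refine ⟨h123.1, h123.2.trans ?_⟩
  rw [h12.2, h1'.2, h2'.2, h3'.2, h1.2, h2.2, h3.2]
  simp only [smul_eq_mul, mul_one_div, ← sub_eq_add_neg]

end Regularized

/-- Analytic continuation of the spectral zeta function to `{Re s > -q} \ {1, 1/2}`,
given a short-time asymptotic expansion of the heat trace with error `O(t^q)`. -/
theorem zeta_analytic_continuation (lam : ℕ → ℝ) (hmono : Monotone lam)
    (hpos : ∀ n, 0 < lam n) (c : ℝ) (hc : 0 < c) (hgrowth : ∀ n, c * (n + 1) ≤ lam n)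
    (θ : ℝ → ℝ) (hθ : ∀ t, θ t = ∑' n, Real.exp (-t * lam n))
    (aneg1 ahalf a0 q C t₀ : ℝ) (hq : q ∈ Set.Ioo (0 : ℝ) (1 / 2)) (hC : 0 < C) (ht₀ : 0 < t₀)
    (hasymp : ∀ t : ℝ, t ∈ Set.Ioo 0 t₀ →
      |θ t - aneg1 * t⁻¹ - ahalf * t ^ (-(1 / 2) : ℝ) - a0| ≤ C * t ^ q)
    (Z : ℂ → ℂ)
    (hZ : ∀ s : ℂ, s ≠ 0 → s ≠ 1 / 2 → s ≠ 1 →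
      Z s = (Complex.Gamma s)⁻¹ *
        ((aneg1 : ℂ) / (s - 1) + (ahalf : ℂ) / (s - 1 / 2) + (a0 : ℂ) / s +
          (∫ t in Set.Ioc (0 : ℝ) 1, (t : ℂ) ^ (s - 1) *
            ((θ t - aneg1 * t⁻¹ - ahalf * t ^ (-(1 / 2) : ℝ) - a0 : ℝ) : ℂ)) +
          ∫ t in Set.Ioi (1 : ℝ), (t : ℂ) ^ (s - 1) * (θ t : ℂ))) :
    (∃ Zt : ℂ → ℂ,
      (∀ s : ℂ, s ≠ 0 → s ≠ 1 / 2 → s ≠ 1 → Zt s = Z s) ∧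
      (∀ s : ℂ, -q < s.re → s ≠ 1 → s ≠ 1 / 2 → DifferentiableAt ℂ Zt s)) ∧
    ∀ s : ℂ, 1 < s.re → Z s = ∑' n, (lam n : ℂ) ^ (-s) := by
  have hθ' : θ = fun t ↦ ∑' n, Real.exp (-t * lam n) := funext hθ
  have hcont : ContinuousOn θ (Ioi 0) := hθ' ▸ continuousOn_tsum_exp_neg_mul hc hgrowth
  have htop : θ =O[atTop] fun t ↦ Real.exp (-lam 0 * t) :=
    hθ' ▸ isBigO_tsum_exp_neg_mul hmono hc hgrowth
  set G := regularizedHeatTrace θ aneg1 ahalf a0 with hG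
  have hGloc : LocallyIntegrableOn G (Ioi 0) := locallyIntegrableOn_regularizedHeatTrace hcont
  have hGtop : G =O[atTop] fun t ↦ Real.exp (-lam 0 * t) :=
    isBigO_regularizedHeatTrace_atTop htop
  have hGzero : G =O[𝓝[>] 0] (· ^ (-(-q))) := by
    rw [neg_neg]
    exact isBigO_regularizedHeatTrace_zero ht₀ hasymp
  have hGconv {s : ℂ} (hs : -q < s.re) : MellinConvergent G s :=
    mellinConvergent_of_isBigO_rpow_exp (hpos 0) hGloc hGtop hGzero hs
  let R (s : ℂ) : ℂ := (∫ t in Set.Ioc (0 : ℝ) 1, (t : ℂ) ^ (s - 1) *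
      ((θ t - aneg1 * t⁻¹ - ahalf * t ^ (-(1 / 2) : ℝ) - a0 : ℝ) : ℂ)) +
    ∫ t in Set.Ioi (1 : ℝ), (t : ℂ) ^ (s - 1) * (θ t : ℂ)
  have hR {s : ℂ} (hs : -q < s.re) : mellin G s = R s := by
    rw [mellin_eq_integral_Ioc_add_integral_Ioi (hGconv hs)]
    congr 1
    · exact setIntegral_congr_fun measurableSet_Ioc fun t ht ↦ by
        simp only [hG, regularizedHeatTrace_of_mem_Ioc ht]
    · exact setIntegral_congr_fun measurableSet_Ioi fun t ht ↦ by
        simp only [hG, regularizedHeatTrace_of_one_lt ht]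
  refine ⟨⟨fun s ↦ (Complex.Gamma s)⁻¹ *
    (aneg1 / (s - 1) + ahalf / (s - 1 / 2) + R s) + a0 * (Complex.Gamma (s + 1))⁻¹,
    fun s hs0 hs2 hs1 ↦ ?_, fun s hs hs1 hs2 ↦ ?_⟩, fun s hs ↦ ?_⟩
  · simp only [R, hZ s hs0 hs2 hs1, Complex.Gamma_add_one s hs0, mul_inv]
    ring
  · have hRdiff : DifferentiableAt ℂ R s := by
      refine (mellin_differentiableAt_of_isBigO_rpow_exp (hpos 0) hGloc hGtop hGzero
        hs).congr_of_eventuallyEq ?_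
      filter_upwards [(isOpen_lt continuous_const Complex.continuous_re).mem_nhds hs] with z hz
      exact (hR hz).symm
    have hΓ := Complex.differentiable_one_div_Gamma
    have hΓ' : DifferentiableAt ℂ (fun s : ℂ ↦ (Complex.Gamma (s + 1))⁻¹) s :=
      (hΓ.comp (differentiable_id.add_const (1 : ℂ))) s
    have hd1 : DifferentiableAt ℂ (fun s : ℂ ↦ (aneg1 : ℂ) / (s - 1)) s :=
      (differentiableAt_const _).div (differentiableAt_id.sub_const 1) (sub_ne_zero.mpr hs1)
    have hd2 : DifferentiableAt ℂ (fun s : ℂ ↦ (ahalf : ℂ) / (s - 1 / 2)) s :=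
      (differentiableAt_const _).div (differentiableAt_id.sub_const _) (sub_ne_zero.mpr hs2)
    exact ((hΓ s).mul ((hd1.add hd2).add hRdiff)).add (hΓ'.const_mul _)
  · have hs_pos : 0 < s.re := one_pos.trans hs
    have hs_q : -q < s.re := by linarith [hq.1]
    have hs0 : s ≠ 0 := fun h ↦ by norm_num [h] at hs
    have hs1 : s ≠ 1 := fun h ↦ by norm_num [h] at hs
    have hs2 : s ≠ 1 / 2 := fun h ↦ by norm_num [h] at hs
    have hP := hasMellin_heatPolarPart (a := aneg1) (b := ahalf) (d := a0) hs
    have hsplit : mellin (fun t ↦ (θ t : ℂ)) s =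
        aneg1 / (s - 1) + ahalf / (s - 1 / 2) + a0 / s + R s := by
      rw [← hR hs_q, ← hP.2, ← (hasMellin_add hP.1 (hGconv hs_q)).2]
      congr 1
      funext t
      simp [hG, regularizedHeatTrace]
    have hsum : HasSum (fun n ↦ Complex.Gamma s * 1 / (lam n : ℂ) ^ s)
        (mellin (fun t ↦ (θ t : ℂ)) s) := by
      refine hasSum_mellin (fun n ↦ Or.inr (hpos n)) hs_pos (fun t ht ↦ ?_) ?_
      · have h := (summable_exp_neg_mul_of_linear_growth hc hgrowth ht).hasSum
        rw [← hθ t] at h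
        simpa [mul_comm] using Complex.hasSum_ofReal.mpr h
      · simpa using summable_one_div_rpow_of_linear_growth hc hgrowth hs
    have hZs : Z s = (Complex.Gamma s)⁻¹ * mellin (fun t ↦ (θ t : ℂ)) s := by
      rw [hZ s hs0 hs2 hs1, hsplit]
      simp only [R]
      ring
    rw [hZs, ← hsum.tsum_eq, ← tsum_mul_left]
    refine tsum_congr fun n ↦ ?_
    rw [mul_one, div_eq_mul_inv,
      inv_mul_cancel_left₀ (Complex.Gamma_ne_zero_of_re_pos hs_pos), Complex.cpow_neg]
end

section
/- With the hypotheses and notation of the context, Z extends to a function differentiable at 0 (namely the unique analytic extension of Z through s = 0), and its derivative at s = 0 equals Z′(0) = ∫₀¹ t⁻¹ (θ(t) − a₋₁ t⁻¹ − a₋₁⁄₂ t^{−1/2} − a₀) dt + ∫₁^∞ t⁻¹ θ(t) dt − a₋₁ − 2 a₋₁⁄₂ + γ a₀, where γ is the Euler–Mascheroni constant. -/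
open Real MeasureTheory Complex

theorem continuousAt_mellin_integral {S : Set ℝ} (hS : MeasurableSet S) (hS0 : S ⊆ Set.Ioi 0)
    {f g : ℝ → ℝ} (hf : AEMeasurable f (volume.restrict S)) (hg : IntegrableOn g S)
    {s₀ : ℂ} (hb : ∀ᶠ s : ℂ in nhds s₀, ∀ t ∈ S, t ^ (s.re - 1) * |f t| ≤ g t) :
    ContinuousAt (fun s : ℂ => ∫ t in S, (t : ℂ) ^ (s - 1) * (f t : ℂ)) s₀ := by
  refine continuousAt_of_dominated (bound := g) (.of_forall fun s => ?_) ?_ hg ?_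
  · refine AEStronglyMeasurable.mul ?_ (Complex.measurable_ofReal.comp_aemeasurable
      hf).aestronglyMeasurable
    refine ContinuousOn.aestronglyMeasurable (fun t ht => ?_) hS
    exact (continuousAt_ofReal_cpow_const t _ (.inr (hS0 ht).ne')).continuousWithinAt
  · filter_upwards [hb] with s hs
    filter_upwards [ae_restrict_mem hS] with t ht
    rw [norm_mul, Complex.norm_cpow_eq_rpow_re_of_pos (hS0 ht), Complex.norm_real, Real.norm_eq_abs]
    simpa using hs t ht
  · filter_upwards [ae_restrict_mem hS] with t ht
    have h0 : (t : ℂ) ≠ 0 := Complex.ofReal_ne_zero.2 (hS0 ht).ne'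
    exact ((continuousAt_id.sub continuousAt_const).const_cpow (.inl h0)).mul continuousAt_const

theorem mellin_integral_zero (S : Set ℝ) (f : ℝ → ℝ) :
    ∫ t in S, (t : ℂ) ^ ((0 : ℂ) - 1) * (f t : ℂ) = ((∫ t in S, t⁻¹ * f t : ℝ) : ℂ) := by
  rw [← integral_complex_ofReal]
  congr 1
  ext t
  rw [zero_sub, Complex.cpow_neg_one]
  push_cast
  rfl

theorem hasDerivAt_inv_Gamma_add_one :
    HasDerivAt (fun s : ℂ => (Complex.Gamma (s + 1))⁻¹) (Real.eulerMascheroniConstant : ℂ) 0 := by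
  have h : HasDerivAt Complex.Gamma (-(Real.eulerMascheroniConstant : ℂ)) ((0 : ℂ) + 1) := by
    simpa using Complex.hasDerivAt_Gamma_one
  have hinv := (h.comp_add_const 0 1).inv (by simp)
  simp only [zero_add, Complex.Gamma_one, neg_neg, one_pow, div_one] at hinv
  exact hinv

/-- Multiplying by the identity turns continuity at the origin into differentiability there. -/
theorem hasDerivAt_id_mul_of_continuousAt {A : ℂ → ℂ} (hA : ContinuousAt A 0) :
    HasDerivAt (fun s => s * A s) (A 0) 0 := by
  rw [hasDerivAt_iff_tendsto_slope]
  refine (hA.tendsto.mono_left nhdsWithin_le_nhds).congr' ?_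
  filter_upwards [self_mem_nhdsWithin] with s hs
  have hs : s ≠ 0 := hs
  simp [slope_def_field, hs]

theorem summable_heat_trace {lam : ℕ → ℝ} {c : ℝ} (hc : 0 < c)
    (hgrowth : ∀ n : ℕ, c * (n + 1) ≤ lam n) {t : ℝ} (ht : 0 < t) :
    Summable fun n => Real.exp (-t * lam n) := by
  have h : Summable fun n : ℕ => Real.exp (n * (-(t * c))) :=
    Real.summable_exp_nat_mul_iff.2 (by have := mul_pos ht hc; linarith)
  refine h.of_nonneg_of_le (fun n => (Real.exp_pos _).le) fun n => Real.exp_le_exp.2 ?_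
  have := mul_le_mul_of_nonneg_left (hgrowth n) ht.le
  nlinarith [mul_pos ht hc]

theorem antitoneOn_heat_trace {lam : ℕ → ℝ} (hpos : ∀ n, 0 < lam n)
    (hsum : ∀ t : ℝ, 0 < t → Summable fun n => Real.exp (-t * lam n)) :
    AntitoneOn (fun t : ℝ => ∑' n, Real.exp (-t * lam n)) (Set.Ioi 0) := by
  intro a ha b hb hab
  refine (hsum b hb).tsum_le_tsum (fun n => Real.exp_le_exp.2 ?_) (hsum a ha)
  nlinarith [hpos n]

theorem heat_trace_le_exp_mul {lam : ℕ → ℝ} (hmono : Monotone lam)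
    (hsum : ∀ t : ℝ, 0 < t → Summable fun n => Real.exp (-t * lam n)) {t : ℝ} (ht : 1 ≤ t) :
    ∑' n, Real.exp (-t * lam n) ≤
      Real.exp (-(t - 1) * lam 0) * ∑' n, Real.exp (-1 * lam n) := by
  rw [← tsum_mul_left]
  refine (hsum t (by linarith)).tsum_le_tsum (fun n => ?_) ((hsum 1 one_pos).mul_left _)
  rw [← Real.exp_add]
  refine Real.exp_le_exp.2 ?_
  nlinarith [hmono (Nat.zero_le n)]

/-- A bound near the origin by a positive power extends to `(0, 1]` for the remainder of an
antitone function. -/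
theorem exists_remainder_bound {θ : ℝ → ℝ} (hanti : AntitoneOn θ (Set.Ioi 0))
    (hnn : ∀ t, 0 ≤ θ t) {a b d q C t₀ : ℝ} (hq : 0 ≤ q) (hC : 0 ≤ C) (ht₀ : 0 < t₀)
    (hasymp : ∀ t : ℝ, t ∈ Set.Ioo 0 t₀ →
      |θ t - a * t⁻¹ - b * t ^ (-(1 / 2) : ℝ) - d| ≤ C * t ^ q) :
    ∃ K, ∀ t : ℝ, 0 < t → |θ t - a * t⁻¹ - b * t ^ (-(1 / 2) : ℝ) - d| ≤ K * t ^ q := by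
  set M := θ t₀ + |a| * t₀⁻¹ + |b| * t₀ ^ (-(1 / 2) : ℝ) + |d| with hM
  have hM0 : 0 ≤ M := by have := hnn t₀; positivity
  have hp : 0 < t₀ ^ q := Real.rpow_pos_of_pos ht₀ q
  refine ⟨C + M / t₀ ^ q, fun t ht => ?_⟩
  have htq : 0 < t ^ q := Real.rpow_pos_of_pos ht q
  rcases lt_or_ge t t₀ with h | h
  · refine (hasymp t ⟨ht, h⟩).trans (mul_le_mul_of_nonneg_right ?_ htq.le)
    have : 0 ≤ M / t₀ ^ q := by positivity
    linarith
  · have h1 : |θ t| ≤ θ t₀ := by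
      rw [abs_of_nonneg (hnn t)]
      exact hanti ht₀ ht h
    have h2 : |a * t⁻¹| ≤ |a| * t₀⁻¹ := by
      rw [abs_mul, abs_of_pos (inv_pos.2 ht)]
      gcongr
    have h3 : |b * t ^ (-(1 / 2) : ℝ)| ≤ |b| * t₀ ^ (-(1 / 2) : ℝ) := by
      rw [abs_mul, abs_of_pos (Real.rpow_pos_of_pos ht _)]
      exact mul_le_mul_of_nonneg_left
        (Real.rpow_le_rpow_of_nonpos ht₀ h (by norm_num)) (abs_nonneg b)
    have h4 : |θ t - a * t⁻¹ - b * t ^ (-(1 / 2) : ℝ) - d| ≤ M := by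
      rw [abs_le] at *
      have := neg_abs_le d
      have := le_abs_self d
      constructor <;> linarith [h1.1, h1.2, h2.1, h2.2, h3.1, h3.2]
    have h5 : M ≤ M / t₀ ^ q * t ^ q := by
      rw [div_mul_eq_mul_div, le_div_iff₀ hp]
      exact mul_le_mul_of_nonneg_left (Real.rpow_le_rpow ht₀.le h hq) hM0
    nlinarith [mul_nonneg hC htq.le]

/-- The derivative at `s = 0` of the analytically continued spectral zeta function:
`-Z'(0)` is the logarithm of the zeta-regularized determinant. -/
theorem zeta_deriv_at_zero (lam : ℕ → ℝ) (hmono : Monotone lam)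
    (hpos : ∀ n, 0 < lam n) (c : ℝ) (hc : 0 < c) (hgrowth : ∀ n, c * (n + 1) ≤ lam n)
    (θ : ℝ → ℝ) (hθ : ∀ t, θ t = ∑' n, Real.exp (-t * lam n))
    (aneg1 ahalf a0 q C t₀ : ℝ) (hq : q ∈ Set.Ioo (0 : ℝ) (1 / 2)) (hC : 0 < C) (ht₀ : 0 < t₀)
    (hasymp : ∀ t : ℝ, t ∈ Set.Ioo 0 t₀ →
      |θ t - aneg1 * t⁻¹ - ahalf * t ^ (-(1 / 2) : ℝ) - a0| ≤ C * t ^ q)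
    (Z : ℂ → ℂ)
    (hZ : ∀ s : ℂ, s ≠ 0 → s ≠ 1 / 2 → s ≠ 1 →
      Z s = (Complex.Gamma s)⁻¹ *
        ((aneg1 : ℂ) / (s - 1) + (ahalf : ℂ) / (s - 1 / 2) + (a0 : ℂ) / s +
          (∫ t in Set.Ioc (0 : ℝ) 1, (t : ℂ) ^ (s - 1) *
            ((θ t - aneg1 * t⁻¹ - ahalf * t ^ (-(1 / 2) : ℝ) - a0 : ℝ) : ℂ)) +
          ∫ t in Set.Ioi (1 : ℝ), (t : ℂ) ^ (s - 1) * (θ t : ℂ))) :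
    ∃ Zt : ℂ → ℂ,
      (∀ s : ℂ, s ≠ 0 → s ≠ 1 / 2 → s ≠ 1 → Zt s = Z s) ∧
      DifferentiableAt ℂ Zt 0 ∧
      deriv Zt 0 =
        (((∫ t in Set.Ioc (0 : ℝ) 1,
              t⁻¹ * (θ t - aneg1 * t⁻¹ - ahalf * t ^ (-(1 / 2) : ℝ) - a0)) +
            (∫ t in Set.Ioi (1 : ℝ), t⁻¹ * θ t) - aneg1 - 2 * ahalf +
            Real.eulerMascheroniConstant * a0 : ℝ) : ℂ) := by
  have hsum : ∀ t : ℝ, 0 < t → Summable fun n => Real.exp (-t * lam n) :=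
    fun t ht => summable_heat_trace hc hgrowth ht
  have hanti : AntitoneOn θ (Set.Ioi 0) := by
    rw [funext hθ]
    exact antitoneOn_heat_trace hpos hsum
  have hnn : ∀ t, 0 ≤ θ t := fun t => by
    rw [hθ]
    exact tsum_nonneg fun n => (Real.exp_pos _).le
  have hmeas : AEMeasurable θ (volume.restrict (Set.Ioi 0)) :=
    aemeasurable_restrict_of_antitoneOn measurableSet_Ioi hanti
  have hsub1 : Set.Ioc (0 : ℝ) 1 ⊆ Set.Ioi 0 := fun t ht => ht.1
  have hsub2 : Set.Ioi (1 : ℝ) ⊆ Set.Ioi 0 := Set.Ioi_subset_Ioi zero_le_one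
  obtain ⟨hq0, -⟩ := hq
  obtain ⟨K, hK⟩ := exists_remainder_bound hanti hnn hq0.le hC.le ht₀ hasymp
  have hre : Filter.Tendsto Complex.re (nhds 0) (nhds 0) := Complex.continuous_re.tendsto 0
  have hI1 : ContinuousAt (fun s : ℂ => ∫ t in Set.Ioc (0 : ℝ) 1, (t : ℂ) ^ (s - 1) *
      ((θ t - aneg1 * t⁻¹ - ahalf * t ^ (-(1 / 2) : ℝ) - a0 : ℝ) : ℂ)) 0 := by
    refine continuousAt_mellin_integral (g := fun t => K * t ^ (q / 2 - 1))
      measurableSet_Ioc hsub1 ?_ ?_ ?_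
    · have := hmeas.mono_measure (Measure.restrict_mono hsub1 le_rfl)
      fun_prop
    · refine Integrable.const_mul ?_ K
      exact (intervalIntegrable_iff_integrableOn_Ioc_of_le zero_le_one).1
        (intervalIntegral.intervalIntegrable_rpow' (by linarith))
    · filter_upwards [hre.eventually (lt_mem_nhds (show -(q / 2) < 0 by linarith))]
        with s hs t ht
      have hKq : 0 ≤ K * t ^ q := (abs_nonneg _).trans (hK t ht.1)
      calc t ^ (s.re - 1) * |θ t - aneg1 * t⁻¹ - ahalf * t ^ (-(1 / 2) : ℝ) - a0|
          ≤ t ^ (-(q / 2) - 1) * (K * t ^ q) := by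
            refine mul_le_mul ?_ (hK t ht.1) (abs_nonneg _) (Real.rpow_nonneg ht.1.le _)
            exact Real.rpow_le_rpow_of_exponent_ge ht.1 ht.2 (by linarith)
        _ = K * (t ^ (-(q / 2) - 1) * t ^ q) := by ring
        _ = K * t ^ (q / 2 - 1) := by
            rw [← Real.rpow_add ht.1]
            ring_nf
  have hI2 : ContinuousAt (fun s : ℂ => ∫ t in Set.Ioi (1 : ℝ),
      (t : ℂ) ^ (s - 1) * (θ t : ℂ)) 0 := by
    refine continuousAt_mellin_integral
      (g := fun t => Real.exp (-lam 0 * t) * (Real.exp (lam 0) * θ 1))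
      measurableSet_Ioi hsub2 (hmeas.mono_measure (Measure.restrict_mono hsub2 le_rfl)) ?_ ?_
    · exact (exp_neg_integrableOn_Ioi 1 (hpos 0)).mul_const _
    · filter_upwards [hre.eventually (gt_mem_nhds (show (0 : ℝ) < 1 by norm_num))] with s hs t ht
      have ht : 1 < t := ht
      calc t ^ (s.re - 1) * |θ t| ≤ 1 * θ t := by
            rw [abs_of_nonneg (hnn t)]
            exact mul_le_mul_of_nonneg_right
              (Real.rpow_le_one_of_one_le_of_nonpos ht.le (by linarith)) (hnn t)
        _ ≤ Real.exp (-(t - 1) * lam 0) * θ 1 := by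
            rw [one_mul, hθ, hθ]
            exact heat_trace_le_exp_mul hmono hsum ht.le
        _ = Real.exp (-lam 0 * t) * (Real.exp (lam 0) * θ 1) := by
            rw [← mul_assoc, ← Real.exp_add]
            ring_nf
  set I₁ : ℂ → ℂ := fun s => ∫ t in Set.Ioc (0 : ℝ) 1, (t : ℂ) ^ (s - 1) *
      ((θ t - aneg1 * t⁻¹ - ahalf * t ^ (-(1 / 2) : ℝ) - a0 : ℝ) : ℂ) with hI₁
  set I₂ : ℂ → ℂ := fun s => ∫ t in Set.Ioi (1 : ℝ), (t : ℂ) ^ (s - 1) * (θ t : ℂ) with hI₂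
  set A : ℂ → ℂ := fun s => (aneg1 : ℂ) / (s - 1) + (ahalf : ℂ) / (s - 1 / 2) + I₁ s + I₂ s
    with hA
  have hAc : ContinuousAt A 0 := by
    refine ((ContinuousAt.add ?_ ?_).add hI1).add hI2
    · exact continuousAt_const.div (continuousAt_id.sub continuousAt_const) (by norm_num)
    · exact continuousAt_const.div (continuousAt_id.sub continuousAt_const) (by norm_num)
  have hderiv := hasDerivAt_inv_Gamma_add_one.mul
    ((hasDerivAt_id_mul_of_continuousAt hAc).const_add (a0 : ℂ))
  refine ⟨_, fun s h0 h1 h2 => ?_, hderiv.differentiableAt, hderiv.deriv.trans ?_⟩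
  · have hG := Complex.one_div_Gamma_eq_self_mul_one_div_Gamma_add_one s
    rw [hZ s h0 h1 h2, hG]
    simp only [Pi.mul_apply, hA, hI₁, hI₂]
    field_simp
    ring
  · have h1 : I₁ 0 = _ := mellin_integral_zero (Set.Ioc 0 1)
      fun t => θ t - aneg1 * t⁻¹ - ahalf * t ^ (-(1 / 2) : ℝ) - a0
    have h2 : I₂ 0 = _ := mellin_integral_zero (Set.Ioi 1) θ
    simp only [hA, h1, h2, zero_add, Complex.Gamma_one, inv_one, zero_mul, add_zero, one_mul]
    push_cast
    norm_num
    ring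
end

section
/- Let c, A, B > 0 and a > 0. Suppose f, g : (0,∞) × ℝ² × ℝ² → ℝ are measurable and satisfy |f(t; x, y)| ≤ A t^{a−1} e^{−c|x−y|²/t} and |g(t; x, y)| ≤ B t^{−3/2} e^{−c|x−y|²/t} for all t > 0 and x, y ∈ ℝ². Then for all t > 0 and x, y ∈ ℝ², the space-time convolution f♯g(t; x, y) = ∫₀^t ∫_{ℝ²} f(s; x, z) g(t−s; z, y) dz ds is absolutely convergent and satisfies |f♯g(t; x, y)| ≤ (π A B / c) · B(a+1, 1/2) · t^{a−1/2} e^{−c|x−y|²/t}, where B(·,·) denotes the Beta function. -/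
open Real MeasureTheory

/-- The real Beta function `B(p, q) = ∫₀¹ u^(p-1) (1-u)^(q-1) du`. -/
noncomputable def realBeta (p q : ℝ) : ℝ :=
  ∫ u in Set.Ioo (0 : ℝ) 1, u ^ (p - 1) * (1 - u) ^ (q - 1)

open Set

/-- Scaling of the Beta integral. -/
lemma setIntegral_rpow_mul_sub_rpow {t : ℝ} (ht : 0 < t) (p q : ℝ) :
    ∫ s in Ioo 0 t, s ^ (p - 1) * (t - s) ^ (q - 1) = t ^ (p + q - 1) * realBeta p q := by
  have hscale := intervalIntegral.smul_integral_comp_mul_left (a := 0) (b := 1)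
    (fun s : ℝ => s ^ (p - 1) * (t - s) ^ (q - 1)) t
  rw [mul_zero, mul_one, intervalIntegral.integral_of_le ht.le,
    intervalIntegral.integral_of_le zero_le_one, integral_Ioc_eq_integral_Ioo,
    integral_Ioc_eq_integral_Ioo, smul_eq_mul] at hscale
  rw [← hscale, realBeta, ← integral_const_mul, ← integral_const_mul]
  refine setIntegral_congr_fun measurableSet_Ioo fun u hu => ?_
  have hu0 : 0 ≤ u := hu.1.le
  have hu1 : 0 ≤ 1 - u := by linarith [hu.2]
  have hexp : t ^ (p + q - 1) = t * (t ^ (p - 1) * t ^ (q - 1)) := by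
    rw [← Real.rpow_add ht, mul_comm, ← Real.rpow_add_one ht.ne']
    congr 1
    ring
  have hfac : t - t * u = t * (1 - u) := by ring
  simp only [hfac, Real.mul_rpow ht.le hu0, Real.mul_rpow ht.le hu1, hexp]
  ring

lemma integrableOn_rpow_mul_sub_rpow {t p r : ℝ} (ht : 0 < t) (hp : 0 ≤ p) (hr : -1 < r) :
    IntegrableOn (fun s : ℝ => s ^ p * (t - s) ^ r) (Ioo 0 t) := by
  have hint : IntervalIntegrable (fun s : ℝ => (t - s) ^ r) volume 0 t := by
    have h := (intervalIntegral.intervalIntegrable_rpow' (a := 0) (b := t) hr).comp_sub_left t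
    simpa using h.symm
  have h := hint.continuousOn_mul (g := fun s : ℝ => s ^ p)
    (Real.continuous_rpow_const hp).continuousOn
  exact ((intervalIntegrable_iff_integrableOn_Ioc_of_le ht.le).1 h).mono_set Ioo_subset_Ioc_self

/-- Completing the square in a product of two Gaussians. -/
lemma norm_sub_sq_div_add_norm_sub_sq_div {V : Type*} [NormedAddCommGroup V]
    [InnerProductSpace ℝ V] {s r : ℝ} (hs : 0 < s) (hr : 0 < r) (x y z : V) :
    ‖x - z‖ ^ 2 / s + ‖z - y‖ ^ 2 / r =
      ‖x - y‖ ^ 2 / (s + r) +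
        (s + r) / (s * r) * ‖z - ((r / (s + r)) • x + (s / (s + r)) • y)‖ ^ 2 := by
  have hsr : s + r ≠ 0 := by positivity
  have hxz : x - y = (x - z) + (z - y) := by abel
  have hz : z - ((r / (s + r)) • x + (s / (s + r)) • y) =
      (s / (s + r)) • (z - y) - (r / (s + r)) • (x - z) := by
    have hone : z = (r / (s + r)) • z + (s / (s + r)) • z := by
      rw [← add_smul, ← add_div, add_comm r s, div_self hsr, one_smul]
    nth_rewrite 1 [hone]
    simp only [smul_sub]
    abel
  rw [hz, hxz]
  generalize x - z = u
  generalize z - y = v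
  rw [norm_add_sq_real, norm_sub_sq_real, norm_smul, norm_smul, real_inner_smul_left,
    real_inner_smul_right, mul_pow, mul_pow, Real.norm_eq_abs, Real.norm_eq_abs, sq_abs, sq_abs,
    real_inner_comm u v]
  field_simp
  ring

lemma integrable_exp_neg_mul_norm_sq {V : Type*} [NormedAddCommGroup V]
    [InnerProductSpace ℝ V] [FiniteDimensional ℝ V] [MeasurableSpace V] [BorelSpace V]
    {b : ℝ} (hb : 0 < b) : Integrable fun v : V => Real.exp (-b * ‖v‖ ^ 2) := by
  have h := (GaussianFourier.integrable_cexp_neg_mul_sq_norm_add (V := V) (b := b)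
    (by simpa using hb) 0 0).norm
  refine h.congr (Filter.Eventually.of_forall fun v => ?_)
  simp [Complex.norm_exp, ← Complex.ofReal_pow]

lemma exp_mul_exp_eq_gaussian {V : Type*} [NormedAddCommGroup V] [InnerProductSpace ℝ V]
    {s r : ℝ} (c : ℝ) (hs : 0 < s) (hr : 0 < r) (x y z : V) :
    Real.exp (-c * ‖x - z‖ ^ 2 / s) * Real.exp (-c * ‖z - y‖ ^ 2 / r) =
      Real.exp (-c * ‖x - y‖ ^ 2 / (s + r)) *
        Real.exp (-(c * ((s + r) / (s * r))) *
          ‖z - ((r / (s + r)) • x + (s / (s + r)) • y)‖ ^ 2) := by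
  rw [← Real.exp_add, ← Real.exp_add]
  congr 1
  linear_combination -c * norm_sub_sq_div_add_norm_sub_sq_div hs hr x y z

lemma integrable_gaussian_mul_gaussian {V : Type*} [NormedAddCommGroup V]
    [InnerProductSpace ℝ V] [FiniteDimensional ℝ V] [MeasurableSpace V] [BorelSpace V]
    {c s r : ℝ} (hc : 0 < c) (hs : 0 < s) (hr : 0 < r) (x y : V) :
    Integrable fun z : V =>
      Real.exp (-c * ‖x - z‖ ^ 2 / s) * Real.exp (-c * ‖z - y‖ ^ 2 / r) := by
  simp_rw [exp_mul_exp_eq_gaussian c hs hr]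
  exact ((integrable_exp_neg_mul_norm_sq (by positivity)).comp_sub_right _).const_mul _

lemma integral_gaussian_mul_gaussian {c s r : ℝ} (hc : 0 < c) (hs : 0 < s) (hr : 0 < r)
    (x y : EuclideanSpace ℝ (Fin 2)) :
    ∫ z, Real.exp (-c * ‖x - z‖ ^ 2 / s) * Real.exp (-c * ‖z - y‖ ^ 2 / r) =
      π / c * (s * r / (s + r)) * Real.exp (-c * ‖x - y‖ ^ 2 / (s + r)) := by
  simp_rw [exp_mul_exp_eq_gaussian c hs hr]
  rw [integral_const_mul, integral_sub_right_eq_self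
    (fun v : EuclideanSpace ℝ (Fin 2) => Real.exp (-(c * ((s + r) / (s * r))) * ‖v‖ ^ 2)),
    GaussianFourier.integral_rexp_neg_mul_sq_norm (by positivity)]
  simp only [finrank_euclideanSpace, Fintype.card_fin, Nat.cast_ofNat, ne_eq,
    OfNat.ofNat_ne_zero, not_false_eq_true, div_self, Real.rpow_one]
  field_simp

/-- Inductive step in the bounds for the Levi parametrix series: bound on a single
space-time convolution `f♯g`. -/
theorem sharp_convolution_bound (c A B a : ℝ) (hc : 0 < c) (hA : 0 < A) (hB : 0 < B)
    (ha : 0 < a) (f g : ℝ → EuclideanSpace ℝ (Fin 2) → EuclideanSpace ℝ (Fin 2) → ℝ)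
    (hfm : Measurable fun p : ℝ × EuclideanSpace ℝ (Fin 2) × EuclideanSpace ℝ (Fin 2) =>
      f p.1 p.2.1 p.2.2)
    (hgm : Measurable fun p : ℝ × EuclideanSpace ℝ (Fin 2) × EuclideanSpace ℝ (Fin 2) =>
      g p.1 p.2.1 p.2.2)
    (hf : ∀ t : ℝ, 0 < t → ∀ x y, |f t x y| ≤ A * t ^ (a - 1) * Real.exp (-c * ‖x - y‖ ^ 2 / t))
    (hg : ∀ t : ℝ, 0 < t → ∀ x y, |g t x y| ≤ B * t ^ (-(3 / 2) : ℝ) *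
      Real.exp (-c * ‖x - y‖ ^ 2 / t))
    (t : ℝ) (ht : 0 < t) (x y : EuclideanSpace ℝ (Fin 2)) :
    Integrable (fun p : ℝ × EuclideanSpace ℝ (Fin 2) => f p.1 x p.2 * g (t - p.1) p.2 y)
        ((volume.restrict (Set.Ioo 0 t)).prod volume) ∧
      |∫ s in Set.Ioo (0 : ℝ) t, ∫ z, f s x z * g (t - s) z y| ≤
        (π * A * B / c) * realBeta (a + 1) (1 / 2) * t ^ (a - 1 / 2) *
          Real.exp (-c * ‖x - y‖ ^ 2 / t) := by
  set K : ℝ × EuclideanSpace ℝ (Fin 2) → ℝ := fun p =>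
    A * p.1 ^ (a - 1) * Real.exp (-c * ‖x - p.2‖ ^ 2 / p.1) *
      (B * (t - p.1) ^ (-(3 / 2) : ℝ) * Real.exp (-c * ‖p.2 - y‖ ^ 2 / (t - p.1))) with hK
  have hKsplit (s : ℝ) : (fun z => K (s, z)) = fun z =>
      (A * B * s ^ (a - 1) * (t - s) ^ (-(3 / 2) : ℝ)) *
        (Real.exp (-c * ‖x - z‖ ^ 2 / s) * Real.exp (-c * ‖z - y‖ ^ 2 / (t - s))) := by
    funext z; simp only [hK]; ring
  have hKm : Measurable K := by fun_prop
  have hKnonneg {s : ℝ} (hs : s ∈ Ioo 0 t) (z) : 0 ≤ K (s, z) := by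
    have h0 := hs.1
    have h1 : 0 < t - s := sub_pos.2 hs.2
    positivity
  have hKint {s : ℝ} (hs : s ∈ Ioo 0 t) : Integrable fun z => K (s, z) := by
    rw [hKsplit]
    exact (integrable_gaussian_mul_gaussian hc hs.1 (sub_pos.2 hs.2) x y).const_mul _
  set C : ℝ := π * A * B / c * Real.exp (-c * ‖x - y‖ ^ 2 / t) / t with hC
  have hKeval {s : ℝ} (hs : s ∈ Ioo 0 t) :
      ∫ z, K (s, z) = C * (s ^ (a + 1 - 1) * (t - s) ^ ((1 / 2 : ℝ) - 1)) := by
    have h0 := hs.1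
    have h1 : 0 < t - s := sub_pos.2 hs.2
    rw [hKsplit, integral_const_mul, integral_gaussian_mul_gaussian hc h0 h1, add_sub_cancel,
      show a + 1 - 1 = (a - 1) + 1 by ring, show (1 / 2 : ℝ) - 1 = -(3 / 2) + 1 by norm_num,
      Real.rpow_add_one h0.ne', Real.rpow_add_one h1.ne', hC]
    field_simp
  have hKprod : Integrable K ((volume.restrict (Ioo 0 t)).prod volume) := by
    rw [integrable_prod_iff hKm.aestronglyMeasurable]
    refine ⟨ae_restrict_of_forall_mem measurableSet_Ioo fun s hs => hKint hs, ?_⟩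
    have h := (integrableOn_rpow_mul_sub_rpow (p := a + 1 - 1) (r := (1 / 2 : ℝ) - 1) ht
      (by linarith) (by norm_num)).const_mul C
    refine h.congr (ae_restrict_of_forall_mem measurableSet_Ioo fun s hs => ?_)
    simp only [Real.norm_of_nonneg (hKnonneg hs _)]
    exact (hKeval hs).symm
  have hbound {s : ℝ} (hs : s ∈ Ioo 0 t) (z) : ‖f s x z * g (t - s) z y‖ ≤ K (s, z) := by
    have h0 := hs.1
    rw [norm_mul]
    exact mul_le_mul (hf s h0 x z) (hg (t - s) (sub_pos.2 hs.2) z y) (abs_nonneg _)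
      (by positivity)
  have hmeas : Measurable fun p : ℝ × EuclideanSpace ℝ (Fin 2) =>
      f p.1 x p.2 * g (t - p.1) p.2 y := by
    refine Measurable.mul ?_ ?_
    · exact hfm.comp (g := fun p : ℝ × EuclideanSpace ℝ (Fin 2) × EuclideanSpace ℝ (Fin 2) =>
        f p.1 p.2.1 p.2.2) (f := fun p : ℝ × EuclideanSpace ℝ (Fin 2) => (p.1, x, p.2))
        (by fun_prop)
    · exact hgm.comp (g := fun p : ℝ × EuclideanSpace ℝ (Fin 2) × EuclideanSpace ℝ (Fin 2) =>
        g p.1 p.2.1 p.2.2) (f := fun p : ℝ × EuclideanSpace ℝ (Fin 2) => (t - p.1, p.2, y))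
        (by fun_prop)
  refine ⟨hKprod.mono' hmeas.aestronglyMeasurable ?_, ?_⟩
  · have hmem : ∀ᵐ p ∂((volume.restrict (Ioo 0 t)).prod
        (volume : Measure (EuclideanSpace ℝ (Fin 2)))), p.1 ∈ Ioo 0 t :=
      Measure.quasiMeasurePreserving_fst.ae (ae_restrict_mem measurableSet_Ioo)
    filter_upwards [hmem] with p hp using hbound hp p.2
  · calc |∫ s in Ioo 0 t, ∫ z, f s x z * g (t - s) z y|
        ≤ ∫ s in Ioo 0 t, ∫ z, K (s, z) :=
          norm_integral_le_of_norm_le hKprod.integral_prod_left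
            (ae_restrict_of_forall_mem measurableSet_Ioo fun s hs =>
              norm_integral_le_of_norm_le (hKint hs)
                (Filter.Eventually.of_forall fun z => hbound hs z))
      _ = C * (t ^ (a + 1 + 1 / 2 - 1) * realBeta (a + 1) (1 / 2)) := by
          rw [setIntegral_congr_fun measurableSet_Ioo fun s hs => hKeval hs, integral_const_mul,
            setIntegral_rpow_mul_sub_rpow ht]
      _ = _ := by
          rw [show a + 1 + 1 / 2 - 1 = (a - 1 / 2) + 1 by ring, Real.rpow_add_one ht.ne', hC]
          field_simp
end

section
/- Let c, A, B > 0 and suppose f, g : (0,∞) × ℝ² × ℝ² → ℝ are measurable with |f(t; x, y)| ≤ A t^{−1} e^{−c|x−y|²/t} and |g(t; x, y)| ≤ B t^{−3/2} e^{−c|x−y|²/t} for all t > 0 and x, y ∈ ℝ². Then for every n ≥ 0, all t > 0 and all x, y ∈ ℝ², the iterated convolution f♯ₙg is defined (all intermediate integrals converge absolutely) and satisfies |f♯ₙg(t; x, y)| ≤ A (π^{3/2} B / c)ⁿ · (1/Γ(n/2 + 1)) · t^{n/2 − 1} e^{−c|x−y|²/t}. In particular the series Σ_{n≥0} f♯ₙg(t;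 x, y) converges absolutely for every t > 0 and x, y ∈ ℝ². -/
open Real MeasureTheory

/-- Space-time convolution `f♯g` of two space-time kernels on `ℝ²`. -/
noncomputable def spaceTimeSharp
    (f g : ℝ → EuclideanSpace ℝ (Fin 2) → EuclideanSpace ℝ (Fin 2) → ℝ) :
    ℝ → EuclideanSpace ℝ (Fin 2) → EuclideanSpace ℝ (Fin 2) → ℝ :=
  fun t x y => ∫ s in Set.Ioo (0 : ℝ) t, ∫ z, f s x z * g (t - s) z y

/-- Iterated space-time convolution: `f♯₀g = f`, `f♯_{n+1}g = (f♯ₙg)♯g`. -/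
noncomputable def spaceTimeSharpIter
    (f g : ℝ → EuclideanSpace ℝ (Fin 2) → EuclideanSpace ℝ (Fin 2) → ℝ) :
    ℕ → (ℝ → EuclideanSpace ℝ (Fin 2) → EuclideanSpace ℝ (Fin 2) → ℝ)
  | 0 => f
  | n + 1 => spaceTimeSharp (spaceTimeSharpIter f g n) g

open Set

/-- Completing the square in the product of two Gaussian exponents. -/
lemma norm_sq_div_add_norm_sq_div {V : Type*} [NormedAddCommGroup V] [InnerProductSpace ℝ V]
    {s u : ℝ} (hs : 0 < s) (hu : 0 < u) (x y z : V) :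
    ‖x - z‖ ^ 2 / s + ‖z - y‖ ^ 2 / u =
      ‖x - y‖ ^ 2 / (s + u) +
        (s + u) / (s * u) * ‖z - ((u / (s + u)) • x + (s / (s + u)) • y)‖ ^ 2 := by
  have hsu : s + u ≠ 0 := (add_pos hs hu).ne'
  have h1 : z - ((u / (s + u)) • x + (s / (s + u)) • y) =
      (s / (s + u)) • (z - y) - (u / (s + u)) • (x - z) := by
    have : z = ((s / (s + u)) + (u / (s + u))) • z := by
      rw [← add_div, div_self hsu, one_smul]
    nth_rw 1 [this]
    module
  have h2 : x - y = (x - z) + (z - y) := by abel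
  rw [h1, h2, norm_add_sq_real, norm_sub_sq_real (_ • _) (_ • _), norm_smul, norm_smul,
    inner_smul_left, inner_smul_right, real_inner_comm (x - z) (z - y)]
  simp only [mul_pow, norm_eq_abs, sq_abs, conj_trivial]
  field_simp
  ring

/-- The convolution of two planar Gaussians. -/
lemma integral_exp_neg_norm_sq_mul_exp_neg_norm_sq {c s u : ℝ} (hc : 0 < c) (hs : 0 < s)
    (hu : 0 < u) (x y : EuclideanSpace ℝ (Fin 2)) :
    ∫ z, rexp (-c * ‖x - z‖ ^ 2 / s) * rexp (-c * ‖z - y‖ ^ 2 / u) =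
      π * (s * u) / (c * (s + u)) * rexp (-c * ‖x - y‖ ^ 2 / (s + u)) := by
  have h (z : EuclideanSpace ℝ (Fin 2)) :
      rexp (-c * ‖x - z‖ ^ 2 / s) * rexp (-c * ‖z - y‖ ^ 2 / u) =
      rexp (-c * ‖x - y‖ ^ 2 / (s + u)) * rexp (-(c * ((s + u) / (s * u))) *
        ‖z - ((u / (s + u)) • x + (s / (s + u)) • y)‖ ^ 2) := by
    rw [← exp_add, ← exp_add]
    congr 1
    linear_combination (-c) * norm_sq_div_add_norm_sq_div hs hu x y z
  simp_rw [h]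
  rw [integral_const_mul,
    integral_sub_right_eq_self (fun z : EuclideanSpace ℝ (Fin 2) =>
      rexp (-(c * ((s + u) / (s * u))) * ‖z‖ ^ 2)),
    GaussianFourier.integral_rexp_neg_mul_sq_norm (by positivity), finrank_euclideanSpace_fin]
  norm_num
  field_simp

/-- The Beta integral rescaled to `(0, t)`. -/
lemma setIntegral_Ioo_rpow_mul_sub_rpow {a b t : ℝ} (ha : 0 < a) (hb : 0 < b) (ht : 0 < t) :
    ∫ s in Ioo 0 t, s ^ (a - 1) * (t - s) ^ (b - 1) =
      t ^ (a + b - 1) * (Gamma a * Gamma b / Gamma (a + b)) := by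
  have h := Complex.betaIntegral_scaled a b ht
  rw [intervalIntegral.integral_of_le ht.le, integral_Ioc_eq_integral_Ioo,
    Complex.betaIntegral_eq_Gamma_mul_div _ _ (by simpa) (by simpa), ← Complex.ofReal_add,
    Complex.Gamma_ofReal, Complex.Gamma_ofReal, Complex.Gamma_ofReal] at h
  have h2 : ∫ s in Ioo 0 t, (s : ℂ) ^ ((a : ℂ) - 1) * ((t : ℂ) - s) ^ ((b : ℂ) - 1) =
      ∫ s in Ioo 0 t, ((s ^ (a - 1) * (t - s) ^ (b - 1) : ℝ) : ℂ) := by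
    refine setIntegral_congr_fun measurableSet_Ioo fun s hs => ?_
    rw [Complex.ofReal_mul, Complex.ofReal_cpow hs.1.le, Complex.ofReal_cpow (sub_pos.2 hs.2).le]
    push_cast
    rfl
  rw [h2, integral_complex_ofReal] at h
  have h3 : (t : ℂ) ^ (((a + b : ℝ) : ℂ) - 1) = ((t ^ (a + b - 1) : ℝ) : ℂ) := by
    rw [Complex.ofReal_cpow ht.le]
    push_cast
    rfl
  rw [h3] at h
  exact_mod_cast h

/-- The space-time convolution of two Gaussian majorants converges absolutely, and its value. -/
lemma gaussian_majorant_sharp {c a t C B : ℝ} (hc : 0 < c) (ha : 0 ≤ a) (ht : 0 < t)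
    (hC : 0 ≤ C) (hB : 0 ≤ B) (x y : EuclideanSpace ℝ (Fin 2)) :
    Integrable (fun p : ℝ × EuclideanSpace ℝ (Fin 2) =>
        C * p.1 ^ (a - 1) * rexp (-c * ‖x - p.2‖ ^ 2 / p.1) *
          (B * (t - p.1) ^ (-(3 / 2) : ℝ) * rexp (-c * ‖p.2 - y‖ ^ 2 / (t - p.1))))
      ((volume.restrict (Ioo 0 t)).prod volume) ∧
    ∫ p, (fun p : ℝ × EuclideanSpace ℝ (Fin 2) =>
        C * p.1 ^ (a - 1) * rexp (-c * ‖x - p.2‖ ^ 2 / p.1) *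
          (B * (t - p.1) ^ (-(3 / 2) : ℝ) * rexp (-c * ‖p.2 - y‖ ^ 2 / (t - p.1)))) p
      ∂((volume.restrict (Ioo 0 t)).prod volume) =
      C * (π ^ ((3 : ℝ) / 2) * B / c) * (Gamma (a + 1) / Gamma (a + 1 / 2 + 1)) *
        t ^ (a + 1 / 2 - 1) * rexp (-c * ‖x - y‖ ^ 2 / t) := by
  set K : ℝ × EuclideanSpace ℝ (Fin 2) → ℝ := fun p =>
        C * p.1 ^ (a - 1) * rexp (-c * ‖x - p.2‖ ^ 2 / p.1) *
          (B * (t - p.1) ^ (-(3 / 2) : ℝ) * rexp (-c * ‖p.2 - y‖ ^ 2 / (t - p.1))) with hK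
  have hKm : Measurable K := by fun_prop
  set D : ℝ := C * B * (π / (c * t)) * rexp (-c * ‖x - y‖ ^ 2 / t) with hD
  have hsplit (s : ℝ) : (fun z => K (s, z)) = fun z =>
      (C * s ^ (a - 1) * (B * (t - s) ^ (-(3 / 2) : ℝ))) *
        (rexp (-c * ‖x - z‖ ^ 2 / s) * rexp (-c * ‖z - y‖ ^ 2 / (t - s))) := by
    funext z
    simp only [hK]
    ring
  have hgauss {s : ℝ} (hs : s ∈ Ioo 0 t) := integral_exp_neg_norm_sq_mul_exp_neg_norm_sq hc
    hs.1 (sub_pos.2 hs.2) x y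
  have hint {s : ℝ} (hs : s ∈ Ioo 0 t) : Integrable (fun z => K (s, z)) := by
    rw [hsplit]
    refine Integrable.const_mul (Integrable.of_integral_ne_zero ?_) _
    have h1 := hs.1
    have h2 := sub_pos.2 hs.2
    rw [hgauss hs]
    positivity
  have hval {s : ℝ} (hs : s ∈ Ioo 0 t) :
      ∫ z, K (s, z) = D * (s ^ (a + 1 - 1) * (t - s) ^ ((1 / 2 : ℝ) - 1)) := by
    have h1 := hs.1
    have h2 := sub_pos.2 hs.2
    rw [hsplit, integral_const_mul, hgauss hs, add_sub_cancel, hD]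
    have e1 : s ^ (a + 1 - 1) = s ^ (a - 1) * s := by
      rw [← rpow_add_one h1.ne']; ring_nf
    have e2 : (t - s) ^ ((1 / 2 : ℝ) - 1) = (t - s) ^ (-(3 / 2) : ℝ) * (t - s) := by
      rw [← rpow_add_one h2.ne']; norm_num
    rw [e1, e2]
    field_simp
  have hbeta := setIntegral_Ioo_rpow_mul_sub_rpow (show 0 < a + 1 by linarith)
    (show (0 : ℝ) < 1 / 2 by norm_num) ht
  have hKint : Integrable K ((volume.restrict (Ioo 0 t)).prod volume) := by
    rw [integrable_prod_iff hKm.aestronglyMeasurable]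
    refine ⟨(ae_restrict_mem measurableSet_Ioo).mono fun s hs => hint hs, ?_⟩
    have : Integrable (fun s => D * (s ^ (a + 1 - 1) * (t - s) ^ ((1 / 2 : ℝ) - 1)))
        (volume.restrict (Ioo 0 t)) := by
      refine Integrable.const_mul (Integrable.of_integral_ne_zero ?_) _
      rw [hbeta]
      have := Gamma_pos_of_pos (show 0 < a + 1 by linarith)
      have := Gamma_pos_of_pos (show (0 : ℝ) < 1 / 2 by norm_num)
      have := Gamma_pos_of_pos (show 0 < a + 1 + 1 / 2 by linarith)
      positivity
    refine this.congr ((ae_restrict_mem measurableSet_Ioo).mono fun s hs => ?_)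
    simp only
    rw [← hval hs]
    refine integral_congr_ae (.of_forall fun z => ?_)
    have h1 := hs.1
    have h2 := sub_pos.2 hs.2
    simp only [hK, norm_eq_abs]
    rw [abs_of_nonneg (by positivity)]
  refine ⟨hKint, ?_⟩
  rw [integral_prod _ hKint, setIntegral_congr_fun measurableSet_Ioo fun s hs => hval hs,
    integral_const_mul, hbeta, hD, Real.Gamma_one_half_eq]
  have e1 : t ^ (a + 1 + 1 / 2 - 1) = t ^ (a + 1 / 2 - 1) * t := by
    rw [← rpow_add_one ht.ne']; ring_nf
  have e2 : π ^ ((3 : ℝ) / 2) = π * √π := by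
    rw [sqrt_eq_rpow, mul_comm, ← rpow_add_one pi_ne_zero]; norm_num
  rw [e1, e2, show a + 1 + 1 / 2 = a + 1 / 2 + 1 by ring]
  field_simp

/-- Joint measurability of the space-time convolution. -/
lemma measurable_spaceTimeSharp
    {f g : ℝ → EuclideanSpace ℝ (Fin 2) → EuclideanSpace ℝ (Fin 2) → ℝ}
    (hf : Measurable fun p : ℝ × EuclideanSpace ℝ (Fin 2) × EuclideanSpace ℝ (Fin 2) =>
      f p.1 p.2.1 p.2.2)
    (hg : Measurable fun p : ℝ × EuclideanSpace ℝ (Fin 2) × EuclideanSpace ℝ (Fin 2) =>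
      g p.1 p.2.1 p.2.2) :
    Measurable fun p : ℝ × EuclideanSpace ℝ (Fin 2) × EuclideanSpace ℝ (Fin 2) =>
      spaceTimeSharp f g p.1 p.2.1 p.2.2 := by
  have h1 : Measurable fun q : ((ℝ × EuclideanSpace ℝ (Fin 2) × EuclideanSpace ℝ (Fin 2)) × ℝ) ×
      EuclideanSpace ℝ (Fin 2) =>
      f q.1.2 q.1.1.2.1 q.2 * g (q.1.1.1 - q.1.2) q.2 q.1.1.2.2 := by
    refine Measurable.mul ?_ ?_
    · exact hf.comp (g := fun p => f p.1 p.2.1 p.2.2)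
        (f := fun q : ((ℝ × EuclideanSpace ℝ (Fin 2) × EuclideanSpace ℝ (Fin 2)) × ℝ) ×
          EuclideanSpace ℝ (Fin 2) => (q.1.2, q.1.1.2.1, q.2)) (by fun_prop)
    · exact hg.comp (g := fun p => g p.1 p.2.1 p.2.2)
        (f := fun q : ((ℝ × EuclideanSpace ℝ (Fin 2) × EuclideanSpace ℝ (Fin 2)) × ℝ) ×
          EuclideanSpace ℝ (Fin 2) => (q.1.1.1 - q.1.2, q.2, q.1.1.2.2)) (by fun_prop)
  have h2 := (h1.stronglyMeasurable.integral_prod_right' (ν := volume)).measurable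
  have hS : MeasurableSet
      ({q | 0 < q.2} ∩ {q | q.2 < q.1.1} :
        Set ((ℝ × EuclideanSpace ℝ (Fin 2) × EuclideanSpace ℝ (Fin 2)) × ℝ)) :=
    (measurableSet_lt measurable_const measurable_snd).inter
      (measurableSet_lt measurable_snd measurable_fst.fst)
  have h3 := ((h2.indicator hS).stronglyMeasurable.integral_prod_right' (ν := volume)).measurable
  convert h3 using 2 with p
  rw [spaceTimeSharp, ← integral_indicator measurableSet_Ioo]
  rfl

/-- One convolution step preserves Gaussian majorants. -/
lemma spaceTimeSharp_bound {c a B C : ℝ} (hc : 0 < c) (ha : 0 ≤ a) (hB : 0 ≤ B) (hC : 0 ≤ C)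
    {f g : ℝ → EuclideanSpace ℝ (Fin 2) → EuclideanSpace ℝ (Fin 2) → ℝ}
    (hfm : Measurable fun p : ℝ × EuclideanSpace ℝ (Fin 2) × EuclideanSpace ℝ (Fin 2) =>
      f p.1 p.2.1 p.2.2)
    (hgm : Measurable fun p : ℝ × EuclideanSpace ℝ (Fin 2) × EuclideanSpace ℝ (Fin 2) =>
      g p.1 p.2.1 p.2.2)
    (hf : ∀ t : ℝ, 0 < t → ∀ x y, |f t x y| ≤ C * t ^ (a - 1) * rexp (-c * ‖x - y‖ ^ 2 / t))
    (hg : ∀ t : ℝ, 0 < t → ∀ x y, |g t x y| ≤ B * t ^ (-(3 / 2) : ℝ) *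
      rexp (-c * ‖x - y‖ ^ 2 / t)) {t : ℝ} (ht : 0 < t) (x y : EuclideanSpace ℝ (Fin 2)) :
    Integrable (fun p : ℝ × EuclideanSpace ℝ (Fin 2) => f p.1 x p.2 * g (t - p.1) p.2 y)
      ((volume.restrict (Ioo 0 t)).prod volume) ∧
    |spaceTimeSharp f g t x y| ≤
      C * (π ^ ((3 : ℝ) / 2) * B / c) * (Gamma (a + 1) / Gamma (a + 1 / 2 + 1)) *
        t ^ (a + 1 / 2 - 1) * rexp (-c * ‖x - y‖ ^ 2 / t) := by
  obtain ⟨hK, hKval⟩ := gaussian_majorant_sharp hc ha ht hC hB x y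
  have hFm : Measurable fun p : ℝ × EuclideanSpace ℝ (Fin 2) =>
      f p.1 x p.2 * g (t - p.1) p.2 y := by
    refine Measurable.mul ?_ ?_
    · exact hfm.comp (g := fun p => f p.1 p.2.1 p.2.2)
        (f := fun q : ℝ × EuclideanSpace ℝ (Fin 2) => (q.1, x, q.2)) (by fun_prop)
    · exact hgm.comp (g := fun p => g p.1 p.2.1 p.2.2)
        (f := fun q : ℝ × EuclideanSpace ℝ (Fin 2) => (t - q.1, q.2, y)) (by fun_prop)
  have hle : ∀ᵐ p : ℝ × EuclideanSpace ℝ (Fin 2) ∂((volume.restrict (Ioo 0 t)).prod volume),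
      ‖f p.1 x p.2 * g (t - p.1) p.2 y‖ ≤
        C * p.1 ^ (a - 1) * rexp (-c * ‖x - p.2‖ ^ 2 / p.1) *
          (B * (t - p.1) ^ (-(3 / 2) : ℝ) * rexp (-c * ‖p.2 - y‖ ^ 2 / (t - p.1))) := by
    have hmem : ∀ᵐ p : ℝ × EuclideanSpace ℝ (Fin 2)
        ∂((volume.restrict (Ioo 0 t)).prod volume), p.1 ∈ Ioo 0 t :=
      Measure.quasiMeasurePreserving_fst.ae (ae_restrict_mem measurableSet_Ioo)
    filter_upwards [hmem] with p hp
    rw [norm_mul]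
    exact mul_le_mul (hf _ hp.1 _ _) (hg _ (sub_pos.2 hp.2) _ _) (norm_nonneg _)
      ((abs_nonneg _).trans (hf _ hp.1 _ _))
  have hF := hK.mono' hFm.aestronglyMeasurable hle
  refine ⟨hF, ?_⟩
  have hprod := integral_prod _ hF
  simp only [spaceTimeSharp]
  rw [← hprod, ← hKval]
  exact norm_integral_le_of_norm_le hK hle

/-- Factorial growth of `Gamma` along the half-integers. -/
lemma Gamma_three_halves_mul_factorial_le (k : ℕ) :
    Gamma (3 / 2) * (k.factorial : ℝ) ≤ Gamma ((k : ℝ) + 3 / 2) := by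
  induction k with
  | zero => simp
  | succ k ih =>
    have h : Gamma (((k + 1 : ℕ) : ℝ) + 3 / 2) = (k + 3 / 2) * Gamma ((k : ℝ) + 3 / 2) := by
      rw [← Gamma_add_one (by positivity)]
      push_cast
      ring_nf
    rw [h, Nat.factorial_succ]
    push_cast
    have h0 := Gamma_pos_of_pos (show (0 : ℝ) < 3 / 2 by norm_num)
    calc Gamma (3 / 2) * (((k : ℝ) + 1) * k.factorial)
        = (k + 1) * (Gamma (3 / 2) * k.factorial) := by ring
      _ ≤ (k + 3 / 2) * Gamma ((k : ℝ) + 3 / 2) := by gcongr; norm_num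

/-- The Mittag-Leffler series of index `1 / 2` converges. -/
lemma summable_pow_div_Gamma_half {r : ℝ} (hr : 0 ≤ r) :
    Summable fun n : ℕ => r ^ n * (Gamma ((n : ℝ) / 2 + 1))⁻¹ := by
  have hexp : Summable fun k : ℕ => (r ^ 2) ^ k / (k.factorial : ℝ) :=
    summable_pow_div_factorial _
  refine Summable.even_add_odd ?_ ?_
  · refine hexp.congr fun k => ?_
    rw [pow_mul, Nat.cast_mul, Nat.cast_two, mul_div_cancel_left₀ _ (two_ne_zero' ℝ),
      Gamma_nat_eq_factorial, div_eq_mul_inv]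
  · refine (hexp.mul_left (r / Gamma (3 / 2))).of_nonneg_of_le (fun k => ?_) fun k => ?_
    · have := Gamma_pos_of_pos (show 0 < ((2 * k + 1 : ℕ) : ℝ) / 2 + 1 by positivity)
      positivity
    · have h0 := Gamma_pos_of_pos (show (0 : ℝ) < 3 / 2 by norm_num)
      have e : ((2 * k + 1 : ℕ) : ℝ) / 2 + 1 = k + 3 / 2 := by push_cast; ring
      rw [e]
      calc r ^ (2 * k + 1) * (Gamma ((k : ℝ) + 3 / 2))⁻¹
          ≤ r ^ (2 * k + 1) * (Gamma (3 / 2) * (k.factorial : ℝ))⁻¹ := by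
            gcongr
            exact Gamma_three_halves_mul_factorial_le k
        _ = r / Gamma (3 / 2) * ((r ^ 2) ^ k / k.factorial) := by
            rw [pow_succ, pow_mul]
            field_simp

/-- Bounds on the iterated convolutions in the Levi parametrix series of the
McKean–Singer construction, and absolute convergence of the series. -/
theorem sharpIter_bound (c A B : ℝ) (hc : 0 < c) (hA : 0 < A) (hB : 0 < B)
    (f g : ℝ → EuclideanSpace ℝ (Fin 2) → EuclideanSpace ℝ (Fin 2) → ℝ)
    (hfm : Measurable fun p : ℝ × EuclideanSpace ℝ (Fin 2) × EuclideanSpace ℝ (Fin 2) =>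
      f p.1 p.2.1 p.2.2)
    (hgm : Measurable fun p : ℝ × EuclideanSpace ℝ (Fin 2) × EuclideanSpace ℝ (Fin 2) =>
      g p.1 p.2.1 p.2.2)
    (hf : ∀ t : ℝ, 0 < t → ∀ x y, |f t x y| ≤ A * t⁻¹ * Real.exp (-c * ‖x - y‖ ^ 2 / t))
    (hg : ∀ t : ℝ, 0 < t → ∀ x y, |g t x y| ≤ B * t ^ (-(3 / 2) : ℝ) *
      Real.exp (-c * ‖x - y‖ ^ 2 / t)) :
    (∀ n : ℕ, ∀ t : ℝ, 0 < t → ∀ x y : EuclideanSpace ℝ (Fin 2),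
      Integrable
        (fun p : ℝ × EuclideanSpace ℝ (Fin 2) =>
          spaceTimeSharpIter f g n p.1 x p.2 * g (t - p.1) p.2 y)
        ((volume.restrict (Set.Ioo 0 t)).prod volume) ∧
      |spaceTimeSharpIter f g n t x y| ≤
        A * (π ^ ((3 : ℝ) / 2) * B / c) ^ n * (Real.Gamma ((n : ℝ) / 2 + 1))⁻¹ *
          t ^ ((n : ℝ) / 2 - 1) * Real.exp (-c * ‖x - y‖ ^ 2 / t)) ∧
    ∀ t : ℝ, 0 < t → ∀ x y : EuclideanSpace ℝ (Fin 2),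
      Summable fun n : ℕ => |spaceTimeSharpIter f g n t x y| := by
  have hbd : ∀ n : ℕ,
      (Measurable fun p : ℝ × EuclideanSpace ℝ (Fin 2) × EuclideanSpace ℝ (Fin 2) =>
        spaceTimeSharpIter f g n p.1 p.2.1 p.2.2) ∧
      ∀ t : ℝ, 0 < t → ∀ x y : EuclideanSpace ℝ (Fin 2), |spaceTimeSharpIter f g n t x y| ≤
        A * (π ^ ((3 : ℝ) / 2) * B / c) ^ n * (Real.Gamma ((n : ℝ) / 2 + 1))⁻¹ *
          t ^ ((n : ℝ) / 2 - 1) * Real.exp (-c * ‖x - y‖ ^ 2 / t) := by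
    intro n
    induction n with
    | zero =>
      refine ⟨hfm, fun t ht x y => ?_⟩
      simpa [spaceTimeSharpIter, rpow_neg_one] using hf t ht x y
    | succ n ih =>
      refine ⟨measurable_spaceTimeSharp ih.1 hgm, fun t ht x y => ?_⟩
      have hG := Gamma_pos_of_pos (show 0 < (n : ℝ) / 2 + 1 by positivity)
      refine (spaceTimeSharp_bound hc (by positivity) hB.le (by positivity) ih.1 hgm ih.2 hg
        ht x y).2.trans_eq ?_
      have e : ((n + 1 : ℕ) : ℝ) / 2 = (n : ℝ) / 2 + 1 / 2 := by push_cast; ring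
      rw [e]
      generalize π ^ ((3 : ℝ) / 2) * B / c = r
      field_simp
      ring
  refine ⟨fun n t ht x y => ⟨?_, (hbd n).2 t ht x y⟩, fun t ht x y => ?_⟩
  · have hG := Gamma_pos_of_pos (show 0 < (n : ℝ) / 2 + 1 by positivity)
    exact (spaceTimeSharp_bound hc (by positivity) hB.le (by positivity) (hbd n).1 hgm
      (hbd n).2 hg ht x y).1
  · have hsum := (summable_pow_div_Gamma_half
      (r := π ^ ((3 : ℝ) / 2) * B / c * √t) (by positivity)).mul_left
        (A * t⁻¹ * Real.exp (-c * ‖x - y‖ ^ 2 / t))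
    refine hsum.of_nonneg_of_le (fun n => abs_nonneg _) fun n =>
      ((hbd n).2 t ht x y).trans_eq ?_
    have e : t ^ ((n : ℝ) / 2 - 1) = √t ^ n * t⁻¹ := by
      rw [sub_eq_add_neg, rpow_add ht, rpow_neg_one, sqrt_eq_rpow, ← rpow_natCast,
        ← rpow_mul ht.le]
      ring_nf
    rw [e, mul_pow]
    ring
end
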